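/- arXiv:1811.07379 — 2 statements merged into one kernel-verified Lean document; each statement's English description precedes it below -/
import Mathlib

section
/- Let K ⊆ V ⊗ k be a strictly characteristic subspace. Then K contains no nonzero vector of the form v ⊗ 1 with v ∈ V; that is, K ∩ (V ⊗ 1) = 0. -/
open TensorProduct

noncomputable section

variable (p : ℕ) [Fact p.Prime] (k : Type) [Field k] [CharP k p] [Algebra (ZMod p) k]

/-- The `p`-power (Frobenius) map on `k` as a `ZMod p`-linear map. -/
def frobLin : k →ₗ[ZMod p] k where
  toFun a := a ^ p
  map_add' a b := add_pow_char a b p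
  map_smul' c a := by
    simp only [RingHom.id_apply]
    rw [Algebra.smul_def, Algebra.smul_def, mul_pow, ← map_pow, ZMod.pow_card]

variable (V : Type) [AddCommGroup V] [Module (ZMod p) V]

/-- The Frobenius-semilinear endomorphism `φ = id_V ⊗ (λ ↦ λ^p)` of `k ⊗[𝔽_p] V`. -/
def frobT : (k ⊗[ZMod p] V) →ₛₗ[frobenius k p] (k ⊗[ZMod p] V) where
  toFun := LinearMap.rTensor V (frobLin p k)
  map_add' := map_add _
  map_smul' c x := by
    induction x using TensorProduct.induction_on with
    | zero => simp
    | tmul a v =>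
        simp [smul_tmul', frobLin, frobenius_def, mul_pow]
    | add x y hx hy => simp_all [smul_add]

variable [IsAlgClosed k]

instance : RingHomSurjective (frobenius k p) := ⟨surjective_frobenius k p⟩

/-- The base change to `k` of the bilinear form `B`. -/
abbrev bcForm (B : LinearMap.BilinForm (ZMod p) V) :
    LinearMap.BilinForm k (k ⊗[ZMod p] V) :=
  LinearMap.BilinForm.baseChange k B

variable (σ₀ : ℕ) (B : LinearMap.BilinForm (ZMod p) V)

/-- `K ⊆ V ⊗ k` is a characteristic subspace: totally isotropic of dimension `σ₀`,
and `K + φ(K)` has dimension `σ₀ + 1`. -/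
def IsCharacteristicSub (K : Submodule k (k ⊗[ZMod p] V)) : Prop :=
  (∀ x ∈ K, ∀ y ∈ K, bcForm p k V B x y = 0) ∧
  Module.finrank k K = σ₀ ∧
  Module.finrank k ↥(K ⊔ Submodule.map (frobT p k V) K) = σ₀ + 1

/-- `K` is strictly characteristic if moreover `∑ᵢ φ^i(K) = V ⊗ k`. -/
def IsStrictlyCharacteristicSub (K : Submodule k (k ⊗[ZMod p] V)) : Prop :=
  IsCharacteristicSub p k V σ₀ B K ∧
  (⨆ i : ℕ, (Submodule.map (frobT p k V))^[i] K) = ⊤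

/-- `l_K = K ∩ φ(K) ∩ ⋯ ∩ φ^{σ₀ − 1}(K)`. -/
def lK (K : Submodule k (k ⊗[ZMod p] V)) : Submodule k (k ⊗[ZMod p] V) :=
  ⨅ i : Fin σ₀, (Submodule.map (frobT p k V))^[(i : ℕ)] K

/-- The group `O_K(V)` of isometries of `(V, B)` such that `g ⊗ k` maps `K` to itself. -/
def OK (K : Submodule k (k ⊗[ZMod p] V)) : Subgroup (V ≃ₗ[ZMod p] V) where
  carrier := {g : V ≃ₗ[ZMod p] V | (∀ x y : V, B (g x) (g y) = B x y) ∧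
    Submodule.map (LinearMap.baseChange k (g : V →ₗ[ZMod p] V)) K = K}
  one_mem' := by
    refine ⟨fun x y => rfl, ?_⟩
    rw [LinearEquiv.coe_toLinearMap_one, LinearMap.baseChange_id, Submodule.map_id]
  mul_mem' := by
    rintro g h ⟨hg1, hg2⟩ ⟨hh1, hh2⟩
    refine ⟨fun x y => (hg1 (h x) (h y)).trans (hh1 x y), ?_⟩
    have hco : ((g * h : V ≃ₗ[ZMod p] V) : V →ₗ[ZMod p] V)
        = (g : V →ₗ[ZMod p] V).comp (h : V →ₗ[ZMod p] V) := rfl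
    rw [hco, LinearMap.baseChange_comp, Submodule.map_comp, hh2, hg2]
  inv_mem' := by
    rintro g ⟨hg1, hg2⟩
    constructor
    · intro x y
      have h1 : g (g⁻¹ x) = x := g.apply_symm_apply x
      have h2 : g (g⁻¹ y) = y := g.apply_symm_apply y
      have := hg1 (g⁻¹ x) (g⁻¹ y)
      rw [h1, h2] at this
      exact this.symm
    · conv_lhs => rw [← hg2]
      rw [← Submodule.map_comp, ← LinearMap.baseChange_comp]
      have hco : ((g⁻¹ : V ≃ₗ[ZMod p] V) : V →ₗ[ZMod p] V).comp (g : V →ₗ[ZMod p] V)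
          = LinearMap.id := by
        ext x
        exact g.symm_apply_apply x
      rw [hco, LinearMap.baseChange_id, Submodule.map_id]

end

theorem bcForm_frobT_aux
    (p : ℕ) [Fact p.Prime]
    (k : Type) [Field k] [CharP k p] [Algebra (ZMod p) k] [IsAlgClosed k]
    (V : Type) [AddCommGroup V] [Module (ZMod p) V]
    (B : LinearMap.BilinForm (ZMod p) V) (v : V) (y : k ⊗[ZMod p] V) :
    bcForm p k V B ((1 : k) ⊗ₜ[ZMod p] v) (frobT p k V y)
      = (bcForm p k V B ((1 : k) ⊗ₜ[ZMod p] v) y) ^ p := by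
  induction y using TensorProduct.induction_on with
  | zero => simp [(Fact.out : p.Prime).ne_zero]
  | tmul a w =>
      have h : frobT p k V (a ⊗ₜ[ZMod p] w) = (a ^ p) ⊗ₜ[ZMod p] w := rfl
      rw [h]
      simp only [bcForm, LinearMap.BilinForm.baseChange_tmul, Algebra.smul_def, mul_pow,
        ← map_pow, ZMod.pow_card, one_mul, mul_one]
  | add x y hx hy => rw [map_add, map_add, map_add, hx, hy, add_pow_char]

/-- a strictly characteristic subspace `K` contains no nonzero vector of
the form `v ⊗ 1` with `v ∈ V`, i.e. `K ∩ (V ⊗ 1) = 0`. -/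
theorem statement4
    (p : ℕ) [Fact p.Prime] (hodd : Odd p)
    (k : Type) [Field k] [CharP k p] [Algebra (ZMod p) k] [IsAlgClosed k]
    (V : Type) [AddCommGroup V] [Module (ZMod p) V]
    (σ₀ : ℕ) (hσ : 1 ≤ σ₀)
    (hdim : Module.finrank (ZMod p) V = 2 * σ₀)
    (B : LinearMap.BilinForm (ZMod p) V)
    (hsymm : B.IsSymm) (hnd : B.Nondegenerate)
    (hnn : ∀ W : Submodule (ZMod p) V,
      (∀ x ∈ W, ∀ y ∈ W, B x y = 0) → Module.finrank (ZMod p) W ≠ σ₀)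
    (K : Submodule k (k ⊗[ZMod p] V))
    (hK : IsStrictlyCharacteristicSub p k V σ₀ B K)
    :
    ∀ v : V, ((1 : k) ⊗ₜ[ZMod p] v) ∈ K → v = 0 := by
  intro v hv
  obtain ⟨⟨hiso, -, -⟩, htop⟩ := hK
  have hle : ∀ i : ℕ, (Submodule.map (frobT p k V))^[i] K
      ≤ LinearMap.ker (bcForm p k V B ((1 : k) ⊗ₜ[ZMod p] v)) := by
    intro i
    induction i with
    | zero =>
        intro y hy
        exact hiso _ hv y hy
    | succ n ih =>
        rw [Function.iterate_succ_apply']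
        rintro _ ⟨y, hy, rfl⟩
        have h0 : bcForm p k V B ((1 : k) ⊗ₜ[ZMod p] v) y = 0 := ih hy
        rw [LinearMap.mem_ker, bcForm_frobT_aux, h0,
          zero_pow (Fact.out : p.Prime).ne_zero]
  have hker := iSup_le hle
  rw [htop] at hker
  refine hnd.1 v fun w => ?_
  have h1 : bcForm p k V B ((1 : k) ⊗ₜ[ZMod p] v) ((1 : k) ⊗ₜ[ZMod p] w) = 0 :=
    hker Submodule.mem_top
  simpa [bcForm, LinearMap.BilinForm.baseChange_tmul, Algebra.smul_def] using h1
end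

section
/- Let K ⊆ V ⊗ k be a strictly characteristic subspace with normalized generator e of l_K and structure constants a_i = ⟨e, φ^{σ₀+i}(e)⟩ (1 ≤ i ≤ σ₀ − 1). Let m be a positive divisor of σ₀ such that σ₀/m is odd, and let ζ ∈ k be a primitive (p^m+1)-th root of unity (i.e. ζ has multiplicative order exactly p^m+1). Then there exists g ∈ O_K(V) with (g ⊗ k)(e) = ζ·e if and only if a_i = 0 for every 1 ≤ i ≤ σ₀ − 1 such that 2m does not divide i. -/
open TensorProduct

section abstractPart

variable {k M : Type} [Field k] [AddCommGroup M] [Module k M]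

/-- A combination orthogonal to all shifted vectors vanishes. -/
theorem aux_coeff_zero (b : LinearMap.BilinForm k M) (x : ℕ → M) (s : ℕ)
    (h0 : ∀ i j, i < j + s → j < i + s → b (x i) (x j) = 0)
    (h1 : ∀ i, b (x i) (x (i + s)) = 1)
    (c : Fin (2 * s) → k)
    (hc : ∀ j, b (∑ i, c i • x i) (x j) = 0) : ∀ i, c i = 0 := by
  have key : ∀ n : ℕ, ∀ h : n < 2 * s, c ⟨n, h⟩ = 0 := by
    intro n
    induction n using Nat.strong_induction_on with
    | _ n ih =>
      intro h
      have := hc (n + s)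
      rw [map_sum, LinearMap.sum_apply, Finset.sum_eq_single ⟨n, h⟩] at this
      · simpa [h1] using this
      · intro i _ hi
        rcases lt_trichotomy (i : ℕ) n with hlt | heq | hgt
        · have := ih i hlt i.2
          simp only [Fin.eta] at this
          simp [this]
        · exact absurd (Fin.ext heq) hi
        · have := h0 i (n + s) (by have := i.2; omega) (by omega)
          simp [this]
      · simp
  intro i
  exact key i i.2

theorem aux_li (b : LinearMap.BilinForm k M) (x : ℕ → M) (s : ℕ)
    (h0 : ∀ i j, i < j + s → j < i + s → b (x i) (x j) = 0)
    (h1 : ∀ i, b (x i) (x (i + s)) = 1) :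
    LinearIndependent k (fun i : Fin (2 * s) => x i) := by
  rw [Fintype.linearIndependent_iff]
  intro c hc
  apply aux_coeff_zero b x s h0 h1 c
  intro j
  rw [hc]; simp

theorem aux_nd (b : LinearMap.BilinForm k M) (x : ℕ → M) (s : ℕ)
    (h0 : ∀ i j, i < j + s → j < i + s → b (x i) (x j) = 0)
    (h1 : ∀ i, b (x i) (x (i + s)) = 1)
    (X : Module.Basis (Fin (2 * s)) k M) (hX : ∀ i, X i = x i)
    (d : M) (hd : ∀ i, i < 2 * s → b d (x i) = 0) : d = 0 := by
  have h : b d = 0 := by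
    apply X.ext
    intro i
    rw [hX, hd i i.2]; simp
  have hs := X.sum_repr d
  have := aux_coeff_zero b x s h0 h1 (fun i => X.repr d i) (by
    intro j
    simp only [← hX]
    rw [hs, h]; simp)
  rw [← hs]
  simp [this]

/-- The diagonal map is an isometry, and multiplies `x (2s)` by the expected scalar. -/
theorem aux_diag (b : LinearMap.BilinForm k M) (hb : ∀ u v, b u v = b v u) (x : ℕ → M) (s : ℕ)
    (hs : 1 ≤ s) (h2 : (2 : k) ≠ 0)
    (h0 : ∀ i j, i < j + s → j < i + s → b (x i) (x j) = 0)
    (h1 : ∀ i, b (x i) (x (i + s)) = 1)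
    (X : Module.Basis (Fin (2 * s)) k M) (hX : ∀ i, X i = x i)
    (z : ℕ → k) (hz : ∀ i, z i ≠ 0)
    (hE : ∀ i j, i < j + 2 * s → j < i + 2 * s → b (x i) (x j) = 0 ∨ z i * z j = 1) :
    ∃ G : M →ₗ[k] M, (∀ i, i ≤ 2 * s → G (x i) = z i • x i) ∧
      (∀ u v, b (G u) (G v) = b u v) := by
  let G : M →ₗ[k] M := X.constr k (fun i => z i • x i)
  have hG : ∀ i, i < 2 * s → G (x i) = z i • x i := by
    intro i hi
    have := X.constr_basis k (fun i => z i • x i) ⟨i, hi⟩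
    rw [hX] at this
    exact this
  have hiso : ∀ u v, b (G u) (G v) = b u v := by
    have : b.compl₁₂ G G = b := by
      apply X.ext; intro i
      apply X.ext; intro j
      rw [LinearMap.compl₁₂_apply, hX, hX, hG i i.2, hG j j.2]
      simp only [map_smul, LinearMap.smul_apply, smul_eq_mul]
      rcases hE i j (by omega) (by omega) with h | h
      · simp [h]
      · rw [← mul_assoc, mul_comm (z j), h, one_mul]
    intro u v
    have := congrArg (fun f => f u v) this
    simpa using this
  refine ⟨G, ?_, hiso⟩
  intro i hi
  rcases hi.lt_or_eq with hi | rfl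
  · exact hG i hi
  set d := G (x (2 * s)) - z (2 * s) • x (2 * s) with hd
  have hdj : ∀ j, 1 ≤ j → j < 2 * s → b d (x j) = 0 := by
    intro j hj1 hj2
    have e1 : z j * b (G (x (2 * s))) (x j) = b (x (2 * s)) (x j) := by
      rw [← hiso (x (2 * s)) (x j), hG j hj2]; simp
    apply mul_left_cancel₀ (hz j)
    rw [hd, map_sub, LinearMap.sub_apply, mul_sub, e1]
    simp only [map_smul, LinearMap.smul_apply, smul_eq_mul, mul_zero]
    rcases hE (2 * s) j (by omega) (by omega) with h | h
    · simp [h]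
    · rw [← mul_assoc, mul_comm (z j), h, one_mul, sub_self]
  have hs0 : b (x s) (x 0) = 1 := by
    rw [hb]; simpa using h1 0
  have hdt : d = (b d (x 0)) • x s := by
    rw [← sub_eq_zero]
    apply aux_nd b x s h0 h1 X hX
    intro i hi
    rcases Nat.eq_zero_or_pos i with rfl | hpos
    · simp [hs0]
    · rw [map_sub, LinearMap.sub_apply, hdj i hpos hi]
      simp [h0 s i (by omega) (by omega)]
  set t := b d (x 0) with ht
  have hGx : G (x (2 * s)) = z (2 * s) • x (2 * s) + t • x s := by
    rw [← hdt, hd]; abel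
  have hself : ∀ i, b (x i) (x i) = 0 := fun i => h0 i i (by omega) (by omega)
  have h1s : b (x s) (x (2 * s)) = 1 := by
    have := h1 s
    rwa [← two_mul] at this
  have h1s' : b (x (2 * s)) (x s) = 1 := by rw [hb, h1s]
  have hq := hiso (x (2 * s)) (x (2 * s))
  rw [hGx] at hq
  simp only [map_add, LinearMap.add_apply, map_smul, LinearMap.smul_apply, smul_eq_mul, hself,
    h1s, h1s', mul_zero, mul_one, zero_add, add_zero] at hq
  have ht0 : t = 0 := by
    have : (2 * z (2 * s)) * t = 0 := by linear_combination hq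
    rcases mul_eq_zero.1 this with h | h
    · exact absurd h (mul_ne_zero h2 (hz _))
    · exact h
  rw [hGx, ht0]; simp

end abstractPart

section arith

theorem aux_pow_mul (p m : ℕ) {k : Type} [Field k] (ζ : k) (hζ : ζ ^ (p ^ m + 1) = 1) (q : ℕ) :
    ζ ^ (p ^ (2 * m * q)) = ζ := by
  have hinv : ζ ^ (p ^ m) * ζ = 1 := by rw [← pow_succ, hζ]
  have hz : ζ ≠ 0 := right_ne_zero_of_mul_eq_one hinv
  have h1 : ζ ^ (p ^ m) = ζ⁻¹ := eq_inv_of_mul_eq_one_left hinv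
  induction q with
  | zero => simp
  | succ q ih =>
    rw [show 2 * m * (q + 1) = 2 * m * q + m + m by ring, pow_add, pow_add, pow_mul, pow_mul, ih,
      h1, inv_pow, h1, inv_inv]

theorem aux_root (p m s r : ℕ) {k : Type} [Field k] (ζ : k) (hζ : ζ ^ (p ^ m + 1) = 1)
    (hmd : m ∣ s) (hmodd : Odd (s / m)) (hr : 2 * m ∣ r) : ζ ^ (p ^ (s + r)) * ζ = 1 := by
  obtain ⟨q, rfl⟩ := hr
  obtain ⟨c, hc⟩ := hmodd
  have : s = 2 * m * c + m := by
    rw [← Nat.mul_div_cancel' hmd, hc]; ring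
  rw [this, show 2 * m * c + m + 2 * m * q = 2 * m * (c + q) + m by ring, pow_add, pow_mul,
    aux_pow_mul p m ζ hζ, ← pow_succ, hζ]

theorem aux_dvd (p m s r : ℕ) (hp : 3 ≤ p) (hm : 0 < m) {k : Type} [Field k] (ζ : k)
    (hζ : IsPrimitiveRoot ζ (p ^ m + 1))
    (hmd : m ∣ s) (hmodd : Odd (s / m)) (h : ζ ^ (p ^ (s + r)) * ζ = 1) : 2 * m ∣ r := by
  obtain ⟨c, hc⟩ := hmodd
  have hs : s = 2 * m * c + m := by
    rw [← Nat.mul_div_cancel' hmd, hc]; ring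
  -- reduce `r` modulo `2m`
  set t := r % (2 * m) with ht
  have htlt : t < 2 * m := Nat.mod_lt _ (by omega)
  have hr : r = 2 * m * (r / (2 * m)) + t := (Nat.div_add_mod _ _).symm
  have hz : ζ ≠ 0 := right_ne_zero_of_mul_eq_one h
  have hmz : ζ ^ (p ^ m) = ζ⁻¹ := eq_inv_of_mul_eq_one_left (by rw [← pow_succ, hζ.pow_eq_one])
  have h2 : ζ ^ (p ^ t) = ζ := by
    have e : s + r = 2 * m * (c + r / (2 * m)) + m + t := by
      rw [hs]; conv_lhs => rw [hr]
      ring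
    rw [e, pow_add, pow_add, pow_mul, pow_mul, aux_pow_mul p m ζ hζ.pow_eq_one, hmz, inv_pow] at h
    have := eq_inv_of_mul_eq_one_left h
    exact inv_injective this
  have hpm : 1 ≤ p ^ m := Nat.one_le_pow _ _ (by omega)
  rcases Nat.eq_zero_or_pos t with h0 | hpos
  · exact Nat.dvd_of_mod_eq_zero h0
  exfalso
  rcases lt_or_ge t m with hlt | hge
  · have hlt' : p ^ t < p ^ m := Nat.pow_lt_pow_right (by omega) hlt
    have h1t : 1 < p ^ t := Nat.one_lt_pow hpos.ne' (by omega)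
    have := hζ.pow_inj (i := p ^ t) (j := 1) (by omega) (by omega) (by rw [h2, pow_one])
    omega
  · obtain ⟨w, hw⟩ := Nat.exists_eq_add_of_le hge
    rw [hw, pow_add, pow_mul, hmz, inv_pow] at h2
    have h3 : ζ ^ (p ^ w + 1) = 1 := by
      rw [pow_succ]
      nth_rewrite 2 [← h2]
      exact mul_inv_cancel₀ (pow_ne_zero _ hz)
    have hlt' : p ^ w < p ^ m := Nat.pow_lt_pow_right (by omega) (by omega)
    have := Nat.le_of_dvd (by omega) (hζ.dvd_of_pow_eq_one _ h3)
    omega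

end arith

section concretePart

variable (p : ℕ) [Fact p.Prime] (k : Type) [Field k] [CharP k p] [Algebra (ZMod p) k]
variable (V : Type) [AddCommGroup V] [Module (ZMod p) V]

theorem aux_frobT_tmul (a : k) (v : V) : frobT p k V (a ⊗ₜ v) = (a ^ p) ⊗ₜ v := rfl

theorem aux_frobT_bilin (B : LinearMap.BilinForm (ZMod p) V) (u v : k ⊗[ZMod p] V) :
    LinearMap.BilinForm.baseChange k B (frobT p k V u) (frobT p k V v)
      = (LinearMap.BilinForm.baseChange k B u v) ^ p := by
  induction u using TensorProduct.induction_on with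
  | zero => simp [(Fact.out : p.Prime).ne_zero]
  | add u u' hu hu' => simp only [map_add, LinearMap.add_apply, hu, hu', add_pow_char]
  | tmul a x =>
    induction v using TensorProduct.induction_on with
    | zero => simp [(Fact.out : p.Prime).ne_zero]
    | add u u' hu hu' => simp only [map_add, hu, hu', add_pow_char]
    | tmul c y =>
      rw [aux_frobT_tmul, aux_frobT_tmul, LinearMap.BilinForm.baseChange_tmul,
        LinearMap.BilinForm.baseChange_tmul, Algebra.smul_def, Algebra.smul_def, mul_pow, mul_pow,
        ← map_pow, ZMod.pow_card]

theorem aux_frobT_comm (g : V →ₗ[ZMod p] V) (u : k ⊗[ZMod p] V) :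
    LinearMap.baseChange k g (frobT p k V u) = frobT p k V (LinearMap.baseChange k g u) := by
  induction u using TensorProduct.induction_on with
  | zero => simp
  | add u u' hu hu' => simp only [map_add, hu, hu']
  | tmul a x => simp [aux_frobT_tmul]

theorem aux_frobT_iter_bilin (B : LinearMap.BilinForm (ZMod p) V) (n : ℕ) (u v : k ⊗[ZMod p] V) :
    LinearMap.BilinForm.baseChange k B ((frobT p k V)^[n] u) ((frobT p k V)^[n] v)
      = (LinearMap.BilinForm.baseChange k B u v) ^ (p ^ n) := by
  induction n with
  | zero => simp
  | succ n ih =>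
    rw [Function.iterate_succ_apply', Function.iterate_succ_apply', aux_frobT_bilin, ih, ← pow_mul,
      pow_succ]

theorem aux_frobT_iter_eig (g : (k ⊗[ZMod p] V) →ₗ[k] (k ⊗[ZMod p] V))
    (hg : ∀ u, g (frobT p k V u) = frobT p k V (g u))
    (e : k ⊗[ZMod p] V) (ζ : k) (he : g e = ζ • e) (n : ℕ) :
    g ((frobT p k V)^[n] e) = ζ ^ (p ^ n) • (frobT p k V)^[n] e := by
  induction n with
  | zero => simpa using he
  | succ n ih =>
    rw [Function.iterate_succ_apply', hg, ih, map_smulₛₗ, frobenius_def, ← pow_mul, pow_succ]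

theorem aux_tmul_inj {ι : Type} (b : Module.Basis ι (ZMod p) V) (v w : V)
    (h : (1 : k) ⊗ₜ[ZMod p] v = 1 ⊗ₜ w) : v = w := by
  apply b.repr.injective
  ext i
  have := congrArg (fun u => (Algebra.TensorProduct.basis k b).repr u i) h
  simp only [Algebra.TensorProduct.basis_repr_tmul, one_smul, Finsupp.mapRange_apply] at this
  exact (algebraMap (ZMod p) k).injective this

theorem aux_frobT_repr {ι : Type} (b : Module.Basis ι (ZMod p) V) (u : k ⊗[ZMod p] V) (i : ι) :
    (Algebra.TensorProduct.basis k b).repr (frobT p k V u) i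
      = ((Algebra.TensorProduct.basis k b).repr u i) ^ p := by
  induction u using TensorProduct.induction_on with
  | zero => simp [(Fact.out : p.Prime).ne_zero]
  | add u u' hu hu' => simp only [map_add, Finsupp.add_apply, hu, hu', add_pow_char]
  | tmul a x =>
    simp only [aux_frobT_tmul, Algebra.TensorProduct.basis_repr_tmul, Finsupp.smul_apply,
      Finsupp.mapRange_apply, smul_eq_mul, mul_pow]
    rw [← map_pow, ZMod.pow_card]

theorem aux_frobT_inj : Function.Injective (frobT p k V) := by
  intro u v h
  let b := Module.Basis.ofVectorSpace (ZMod p) V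
  apply (Algebra.TensorProduct.basis k b).repr.injective
  ext i
  apply frobenius_inj k p
  rw [frobenius_def, frobenius_def, ← aux_frobT_repr, ← aux_frobT_repr, h]

theorem aux_mem_range (a : k) (ha : a ^ p = a) : ∃ c : ZMod p, algebraMap (ZMod p) k c = a := by
  have h := (Subfield.mem_bot_iff_pow_eq_self (p := p) (x := a)).2 ha
  have h2 : (⊥ : Subfield k) ≤ (algebraMap (ZMod p) k).fieldRange := bot_le
  exact h2 h

theorem aux_fixed (u : k ⊗[ZMod p] V) (h : frobT p k V u = u) : ∃ v : V, u = 1 ⊗ₜ v := by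
  let b := Module.Basis.ofVectorSpace (ZMod p) V
  let bk := Algebra.TensorProduct.basis k b
  have hc : ∀ i, ∃ c : ZMod p, algebraMap (ZMod p) k c = bk.repr u i := by
    intro i
    apply aux_mem_range p k
    rw [← aux_frobT_repr, h]
  choose c hc using hc
  rw [← bk.linearCombination_repr u, Finsupp.linearCombination_apply, Finsupp.sum]
  refine ⟨∑ i ∈ (bk.repr u).support, c i • b i, ?_⟩
  rw [TensorProduct.tmul_sum]
  apply Finset.sum_congr rfl
  intro i _
  rw [← hc, Algebra.TensorProduct.basis_apply, algebraMap_smul, TensorProduct.tmul_smul]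

theorem aux_descend (G : (k ⊗[ZMod p] V) →ₗ[k] (k ⊗[ZMod p] V))
    (hG : ∀ u, G (frobT p k V u) = frobT p k V (G u)) :
    ∃ g : V →ₗ[ZMod p] V, LinearMap.baseChange k g = G := by
  let b := Module.Basis.ofVectorSpace (ZMod p) V
  have h : ∀ v : V, ∃ w : V, G (1 ⊗ₜ v) = 1 ⊗ₜ w := by
    intro v
    apply aux_fixed
    rw [← hG, aux_frobT_tmul, one_pow]
  choose f hf using h
  refine ⟨b.constr (ZMod p) (fun i => f (b i)), ?_⟩
  apply (Algebra.TensorProduct.basis k b).ext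
  intro i
  rw [Algebra.TensorProduct.basis_apply, LinearMap.baseChange_tmul, b.constr_basis, hf]

variable [IsAlgClosed k]

theorem aux_mem_iter (K : Submodule k (k ⊗[ZMod p] V)) (n : ℕ) (y : k ⊗[ZMod p] V) :
    y ∈ (Submodule.map (frobT p k V))^[n] K ↔ ∃ x ∈ K, (frobT p k V)^[n] x = y := by
  induction n generalizing y with
  | zero => simp
  | succ n ih =>
    rw [Function.iterate_succ_apply', Submodule.mem_map]
    constructor
    · rintro ⟨w, hw, rfl⟩
      obtain ⟨x, hx, rfl⟩ := (ih w).1 hw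
      exact ⟨x, hx, Function.iterate_succ_apply' _ _ _⟩
    · rintro ⟨x, hx, rfl⟩
      exact ⟨_, (ih _).2 ⟨x, hx, rfl⟩, (Function.iterate_succ_apply' _ _ _).symm⟩

theorem aux_finrank_map [FiniteDimensional k (k ⊗[ZMod p] V)] (K : Submodule k (k ⊗[ZMod p] V)) :
    Module.finrank k (Submodule.map (frobT p k V) K) ≤ Module.finrank k K := by
  haveI : Module.Free k K := Module.Free.of_divisionRing k K
  let b := Module.finBasis k K
  have hK : K = Submodule.span k (Set.range (fun i => (b i : k ⊗[ZMod p] V))) := by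
    have := congrArg (Submodule.map K.subtype) b.span_eq
    rw [Submodule.map_span, ← Set.range_comp, Submodule.map_top, Submodule.range_subtype] at this
    exact this.symm
  conv_lhs => rw [hK]
  rw [Submodule.map_span, ← Set.range_comp]
  refine (finrank_range_le_card (R := k)
    (frobT p k V ∘ (fun i => (b i : k ⊗[ZMod p] V)))).trans ?_
  rw [Fintype.card_fin]

theorem aux_finrank_iter [FiniteDimensional k (k ⊗[ZMod p] V)] (K : Submodule k (k ⊗[ZMod p] V))
    (n : ℕ) :
    Module.finrank k ((Submodule.map (frobT p k V))^[n] K : Submodule k (k ⊗[ZMod p] V))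
      ≤ Module.finrank k K := by
  induction n with
  | zero => exact le_refl _
  | succ n ih =>
    rw [Function.iterate_succ_apply']
    exact (aux_finrank_map p k V _).trans ih

end concretePart

/-- a primitive `(p^m + 1)`-th root of unity `ζ` (for `m ∣ σ₀` with
`σ₀/m` odd) is an eigenvalue of some `g ∈ O_K(V)` on `e` if and only if the structure
constants `a_i = ⟨e, φ^(σ₀+i)(e)⟩` vanish for all `1 ≤ i ≤ σ₀ - 1` with `2m ∤ i`. -/
theorem statement6
    (p : ℕ) [Fact p.Prime] (hodd : Odd p)
    (k : Type) [Field k] [CharP k p] [Algebra (ZMod p) k] [IsAlgClosed k]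
    (V : Type) [AddCommGroup V] [Module (ZMod p) V]
    (σ₀ : ℕ) (hσ : 1 ≤ σ₀)
    (hdim : Module.finrank (ZMod p) V = 2 * σ₀)
    (B : LinearMap.BilinForm (ZMod p) V)
    (hsymm : B.IsSymm) (hnd : B.Nondegenerate)
    (hnn : ∀ W : Submodule (ZMod p) V,
      (∀ x ∈ W, ∀ y ∈ W, B x y = 0) → Module.finrank (ZMod p) W ≠ σ₀)
    (K : Submodule k (k ⊗[ZMod p] V))
    (hK : IsStrictlyCharacteristicSub p k V σ₀ B K)
    (e : k ⊗[ZMod p] V)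
    (hgen : Submodule.span k {e} = lK p k V σ₀ K)
    (hnorm : bcForm p k V B e ((⇑(frobT p k V))^[σ₀] e) = 1)
    (m : ℕ) (hm0 : 0 < m) (hmd : m ∣ σ₀) (hmodd : Odd (σ₀ / m))
    (ζ : k) (hζ : IsPrimitiveRoot ζ (p ^ m + 1)) :
    (∃ g ∈ OK p k V B K,
        LinearMap.baseChange k (g : V →ₗ[ZMod p] V) e = ζ • e)
      ↔ ∀ i : ℕ, 1 ≤ i → i ≤ σ₀ - 1 → ¬ (2 * m ∣ i) →
          bcForm p k V B e ((⇑(frobT p k V))^[σ₀ + i] e) = 0 := by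
  classical
  have hp3 : 3 ≤ p := by
    have h2 := (Fact.out : p.Prime).two_le
    rcases hodd with ⟨c, hc⟩
    omega
  have hfdV : FiniteDimensional (ZMod p) V :=
    Module.finite_of_finrank_pos (by omega)
  have hfd : FiniteDimensional k (k ⊗[ZMod p] V) := inferInstance
  have hfr : Module.finrank k (k ⊗[ZMod p] V) = 2 * σ₀ := by
    rw [Module.finrank_baseChange, hdim]
  obtain ⟨⟨hiso, hKdim, -⟩, -⟩ := hK
  set F := frobT p k V with hF
  set b := bcForm p k V B with hbdef
  have hb : ∀ u v, b u v = b v u := fun u v => 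
    (LinearMap.BilinForm.IsSymm.baseChange k (LinearMap.BilinForm.isSymm_iff.1 hsymm)).eq u v
  set x : ℕ → k ⊗[ZMod p] V := fun n => F^[n] e with hx
  have hbx : ∀ i n, b (x i) (x (i + n)) = (b e (x n)) ^ (p ^ i) := by
    intro i n
    have := aux_frobT_iter_bilin p k V B i e (x n)
    rw [← this]
    simp only [hx, Function.iterate_add_apply]
    rfl
  have hel : ∀ n, n < σ₀ → ∃ y ∈ K, F^[n] y = e := by
    intro n hn
    have : e ∈ lK p k V σ₀ K := hgen ▸ Submodule.mem_span_singleton_self e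
    rw [lK, Submodule.mem_iInf] at this
    exact (aux_mem_iter p k V K n e).1 (this ⟨n, hn⟩)
  have h00 : ∀ n, n < σ₀ → b e (x n) = 0 := by
    intro n hn
    obtain ⟨y, hy, hye⟩ := hel n hn
    obtain ⟨y', hy', hye'⟩ := hel 0 (by omega)
    have h := aux_frobT_iter_bilin p k V B n y e
    have he : e ∈ K := by
      rw [← hye']; exact hy'
    rw [← hF, hye] at h
    change b e (x n) = (b y e) ^ (p ^ n) at h
    rw [h, hiso y hy e he, zero_pow (pow_ne_zero _ (by omega))]
  have hle : ∀ i j, i ≤ j → j < i + σ₀ → b (x i) (x j) = 0 := by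
    intro i j hij hj
    obtain ⟨n, rfl⟩ := Nat.exists_eq_add_of_le hij
    rw [hbx, h00 n (by omega), zero_pow (pow_ne_zero _ (by omega))]
  have h0 : ∀ i j, i < j + σ₀ → j < i + σ₀ → b (x i) (x j) = 0 := by
    intro i j h1 h2
    rcases le_total i j with h | h
    · exact hle i j h h2
    · rw [hb]; exact hle j i h h1
  have h1 : ∀ i, b (x i) (x (i + σ₀)) = 1 := by
    intro i
    rw [hbx]
    change (b e (F^[σ₀] e)) ^ (p ^ i) = 1
    rw [hnorm, one_pow]
  have hζ0 : ζ ≠ 0 := hζ.ne_zero (by omega)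
  constructor
  · rintro ⟨g, hg, hge⟩ i hi1 hi2 hi3
    have hgi := aux_frobT_iter_eig p k V (LinearMap.baseChange k (g : V →ₗ[ZMod p] V))
      (aux_frobT_comm p k V _) e ζ hge (σ₀ + i)
    have hgiso : ∀ u v, b (LinearMap.baseChange k (g : V →ₗ[ZMod p] V) u)
        (LinearMap.baseChange k (g : V →ₗ[ZMod p] V) v) = b u v := by
      intro u v
      induction u using TensorProduct.induction_on with
      | zero => simp
      | add u u' hu hu' => simp only [map_add, LinearMap.add_apply, hu, hu']
      | tmul a y =>
        induction v using TensorProduct.induction_on with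
        | zero => simp
        | add u u' hu hu' => simp only [map_add, hu, hu']
        | tmul c w =>
          simp only [hbdef, LinearMap.baseChange_tmul, LinearMap.BilinForm.baseChange_tmul]
          rw [LinearEquiv.coe_coe, hg.1 y w]
    have h := hgiso e (F^[σ₀ + i] e)
    rw [hge, hgi] at h
    simp only [map_smul, LinearMap.smul_apply, smul_eq_mul] at h
    by_contra hne
    apply hi3
    apply aux_dvd p m σ₀ i hp3 hm0 ζ hζ hmd hmodd
    apply mul_right_cancel₀ hne
    rw [one_mul, mul_assoc]
    exact h
  · intro ha
    have hli := aux_li b x σ₀ h0 h1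
    let X : Module.Basis (Fin (2 * σ₀)) k (k ⊗[ZMod p] V) :=
      basisOfLinearIndependentOfCardEqFinrank' _ hli (by simp [hfr])
    have hX : ∀ i, X i = x i := by
      intro i
      simp [X]
    have hEle : ∀ i j, i ≤ j → j < i + 2 * σ₀ →
        b (x i) (x j) = 0 ∨ ζ ^ (p ^ i) * ζ ^ (p ^ j) = 1 := by
      intro i j hij hj
      rcases lt_or_ge j (i + σ₀) with hlt | hge
      · exact Or.inl (hle i j hij hlt)
      obtain ⟨r, rfl⟩ := Nat.exists_eq_add_of_le hge
      by_cases hr : 2 * m ∣ r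
      · right
        have h := aux_root p m σ₀ r ζ hζ.pow_eq_one hmd hmodd hr
        rw [add_assoc, pow_add p i, mul_comm (p ^ i) (p ^ (σ₀ + r)), pow_mul, ← mul_pow, mul_comm,
          h, one_pow]
      · left
        have hr0 : r ≠ 0 := by rintro rfl; simp at hr
        rw [add_assoc, hbx]
        have h : b e (x (σ₀ + r)) = 0 := ha r (by omega) (by omega) hr
        rw [h, zero_pow (pow_ne_zero _ (by omega))]
    have hE : ∀ i j, i < j + 2 * σ₀ → j < i + 2 * σ₀ →
        b (x i) (x j) = 0 ∨ ζ ^ (p ^ i) * ζ ^ (p ^ j) = 1 := by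
      intro i j h h'
      rcases le_total i j with hij | hij
      · exact hEle i j hij h'
      · rw [hb, mul_comm]; exact hEle j i hij h
    have h2 : (2 : k) ≠ 0 := by
      intro h
      have : p ∣ 2 := (CharP.cast_eq_zero_iff k p 2).1 (by exact_mod_cast h)
      have := Nat.le_of_dvd (by omega) this
      omega
    obtain ⟨G, hGx, hGiso⟩ := aux_diag b hb x σ₀ hσ h2 h0 h1 X hX (fun i => ζ ^ (p ^ i))
      (fun i => pow_ne_zero _ hζ0) hE
    have hxs : ∀ i, F (x i) = x (i + 1) := fun i => (Function.iterate_succ_apply' _ _ _).symm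
    have hGF : ∀ u, G (F u) = F (G u) := by
      have : G.comp F = F.comp G := by
        apply X.ext
        intro i
        rw [LinearMap.comp_apply, LinearMap.comp_apply, hX, hxs, hGx _ (by omega),
          hGx _ (by omega), map_smulₛₗ, hxs, frobenius_def, ← pow_mul, pow_succ]
      intro u
      exact congrArg (fun f => f u) this
    have hGinj : Function.Injective G := by
      rw [← LinearMap.ker_eq_bot, LinearMap.ker_eq_bot']
      intro u hu
      apply aux_nd b x σ₀ h0 h1 X hX
      intro i _
      rw [← hGiso, hu]; simp
    obtain ⟨g, hgG⟩ := aux_descend p k V G hGF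
    let bV := Module.Basis.ofVectorSpace (ZMod p) V
    have hginj : Function.Injective g := by
      intro v w hvw
      apply aux_tmul_inj p k V bV
      apply hGinj
      rw [← hgG, LinearMap.baseChange_tmul, LinearMap.baseChange_tmul, hvw]
    let g' : V ≃ₗ[ZMod p] V := LinearEquiv.ofInjectiveEndo g hginj
    have hg' : (g' : V →ₗ[ZMod p] V) = g := by
      ext v; simp [g']
    have hGe : G e = ζ • e := by
      simpa [hx] using hGx 0 (by omega)
    refine ⟨g', ⟨?_, ?_⟩, ?_⟩
    · intro v w
      have h := hGiso (1 ⊗ₜ v) (1 ⊗ₜ w)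
      rw [← hgG] at h
      simp only [hbdef, LinearMap.baseChange_tmul, LinearMap.BilinForm.baseChange_tmul, mul_one,
        Algebra.smul_def] at h
      have h' := (algebraMap (ZMod p) k).injective h
      rw [← hg'] at h'
      exact h'
    · rw [hg', hgG]
      set L := (Submodule.map F)^[σ₀ - 1] K with hL
      let S := Submodule.span k (Set.range (fun i : Fin σ₀ => x i))
      have hSL : S ≤ L := by
        rw [Submodule.span_le]
        rintro _ ⟨i, rfl⟩
        obtain ⟨y, hy, hye⟩ := hel (σ₀ - 1 - i) (by omega)
        apply (aux_mem_iter p k V K _ _).2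
        refine ⟨y, hy, ?_⟩
        simp only [hx]
        rw [← hye, ← Function.iterate_add_apply]
        congr 2
        omega
      have hSdim : Module.finrank k S = σ₀ := by
        have := hli.comp (fun i : Fin σ₀ => (⟨i, by omega⟩ : Fin (2 * σ₀)))
          (by intro i j h; simpa [Fin.ext_iff] using h)
        exact (finrank_span_eq_card this).trans (Fintype.card_fin _)
      have hSeq : S = L := by
        apply Submodule.eq_of_le_of_finrank_le hSL
        rw [hSdim, ← hKdim]
        exact aux_finrank_iter p k V K _
      have hGit : ∀ n u, G (F^[n] u) = F^[n] (G u) := by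
        intro n u
        exact (Function.Commute.iterate_right (f := G) (g := F) hGF n) u
      have hGS : ∀ u ∈ S, G u ∈ S := by
        intro u hu
        have : S ≤ S.comap G := by
          rw [Submodule.span_le]
          rintro _ ⟨i, rfl⟩
          change G (x i) ∈ S
          rw [hGx i (by omega)]
          exact S.smul_mem _ (Submodule.subset_span ⟨i, rfl⟩)
        exact this hu
      have hmapK : Submodule.map G K ≤ K := by
        rintro _ ⟨u, hu, rfl⟩
        have h := hGS (F^[σ₀ - 1] u)
          (hSeq ▸ (aux_mem_iter p k V K (σ₀ - 1) _).2 ⟨u, hu, rfl⟩)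
        rw [hSeq, hGit] at h
        obtain ⟨w, hw, hwe⟩ := (aux_mem_iter p k V K (σ₀ - 1) _).1 h
        have := (aux_frobT_inj p k V).iterate (σ₀ - 1) hwe
        rw [← this]; exact hw
      apply Submodule.eq_of_le_of_finrank_le hmapK
      exact (Submodule.equivMapOfInjective G hGinj K).finrank_eq.le
    · rw [hg', hgG, hGe]
end
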